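/- Polar duality between metric and Gauss deformations: let φ : 𝕊² → ℝ³ be a smooth immersion with unit normal field ν, suppose the support function h := ⟨ν, φ⟩ vanishes nowhere, and let ψ := (1/h)·ν be the polar dual of φ. Let ξ be an isometric infinitesimal deformation of φ with rotation vector field η and translation vector field τ. Then for every x ∈ 𝕊² and all X, Y ∈ T_x𝕊²: ⟨dτ_x X, φ x⟩ = 0 and dτ_x X × dψ_x Y + dψ_x X × dτ_x Y = 0; i.e. τ is an isogauss infinitesimal deformation of the polar dual surface ψ (whose normal direction at ψ x is φ x). -/

import Mathlib

noncomputable section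

open scoped Manifold RealInnerProductSpace
open Metric Module

local notation "ℝ³" => EuclideanSpace ℝ (Fin 3)

instance : Fact (finrank ℝ ℝ³ = 2 + 1) := ⟨by simp⟩

local notation "𝕊²" => sphere (0 : ℝ³) 1

/-- The cross product on `ℝ³ = EuclideanSpace ℝ (Fin 3)`. -/
def cross (a b : ℝ³) : ℝ³ :=
  (EuclideanSpace.equiv (Fin 3) ℝ).symm
    (crossProduct (EuclideanSpace.equiv (Fin 3) ℝ a) (EuclideanSpace.equiv (Fin 3) ℝ b))

/-- `f : 𝕊² → ℝ³` is smooth (`C^∞`). -/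
def Smooth3 (f : 𝕊² → ℝ³) : Prop := ContMDiff (𝓡 2) 𝓘(ℝ, ℝ³) (⊤ : ℕ∞) f

/-- The manifold derivative of `f : 𝕊² → ℝ³` at `x ∈ 𝕊²`. -/
def mfd (f : 𝕊² → ℝ³) (x : 𝕊²) : TangentSpace (𝓡 2) x →L[ℝ] ℝ³ :=
  mfderiv (𝓡 2) 𝓘(ℝ, ℝ³) f x

/-- `ν` is a unit normal field for `φ`. -/
def IsUnitNormalField (φ ν : 𝕊² → ℝ³) : Prop :=
  Smooth3 ν ∧ (∀ x, ‖ν x‖ = 1) ∧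
    ∀ (x : 𝕊²) (X : TangentSpace (𝓡 2) x), ⟪ν x, mfd φ x X⟫ = 0

/-- `φ` has everywhere positive Gauss curvature with respect to `ν`. -/
def PosGaussCurvature (φ ν : 𝕊² → ℝ³) : Prop :=
  ∀ (x : 𝕊²) (X Y : TangentSpace (𝓡 2) x), LinearIndependent ℝ ![X, Y] →
    0 < ⟪cross (mfd ν x X) (mfd ν x Y), cross (mfd φ x X) (mfd φ x Y)⟫

/-- `η` is an isogauss infinitesimal deformation of `φ` with respect to `ν`. -/
def IsIsogaussDeformation (φ ν η : 𝕊² → ℝ³) : Prop :=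
  Smooth3 η ∧
    (∀ (x : 𝕊²) (X : TangentSpace (𝓡 2) x), ⟪mfd η x X, ν x⟫ = 0) ∧
    ∀ (x : 𝕊²) (X Y : TangentSpace (𝓡 2) x),
      cross (mfd η x X) (mfd φ x Y) + cross (mfd φ x X) (mfd η x Y) = 0

/-- `ξ` is an isometric infinitesimal deformation of `φ`. -/
def IsIsometricDeformation (φ ξ : 𝕊² → ℝ³) : Prop :=
  Smooth3 ξ ∧
    ∀ (x : 𝕊²) (X Y : TangentSpace (𝓡 2) x),
      ⟪mfd ξ x X, mfd φ x Y⟫ + ⟪mfd φ x X, mfd ξ x Y⟫ = 0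

/-- `η` is the rotation vector field of the isometric infinitesimal deformation `ξ` of `φ`. -/
def IsRotationField (φ ξ η : 𝕊² → ℝ³) : Prop :=
  Smooth3 η ∧
    ∀ (x : 𝕊²) (X : TangentSpace (𝓡 2) x), mfd ξ x X = cross (η x) (mfd φ x X)

section Bilinear

variable {E H M F F' G : Type*} [NormedAddCommGroup E] [NormedSpace ℝ E] [TopologicalSpace H]
  {I : ModelWithCorners ℝ E H} [TopologicalSpace M] [ChartedSpace H M]
  [NormedAddCommGroup F] [NormedSpace ℝ F] [NormedAddCommGroup F'] [NormedSpace ℝ F']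
  [NormedAddCommGroup G] [NormedSpace ℝ G]

/-- The product rule for a continuous bilinear map applied to two functions on a manifold. -/
theorem HasMFDerivAt.of_bilinear (B : F →L[ℝ] F' →L[ℝ] G) {f : M → F} {g : M → F'} {x : M}
    {f' : E →L[ℝ] F} {g' : E →L[ℝ] F'}
    (hf : HasMFDerivAt I 𝓘(ℝ, F) f x f') (hg : HasMFDerivAt I 𝓘(ℝ, F') g x g') :
    HasMFDerivAt I 𝓘(ℝ, G) (fun y => B (f y) (g y)) x
      (B.precompR E (f x) g' + B.precompL E f' (g x) : E →L[ℝ] G) :=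
  ⟨(B.continuous₂.continuousAt.comp (hf.1.prodMk hg.1) :), by
    simpa only [mfld_simps] using! B.hasFDerivWithinAt_of_bilinear hf.2 hg.2⟩

theorem mfderiv_bilinear_apply (B : F →L[ℝ] F' →L[ℝ] G) {f : M → F} {g : M → F'} {x : M}
    (hf : MDifferentiableAt I 𝓘(ℝ, F) f x) (hg : MDifferentiableAt I 𝓘(ℝ, F') g x)
    (X : TangentSpace I x) :
    (mfderiv I 𝓘(ℝ, G) (fun y => B (f y) (g y)) x X : G) =
      B (f x) (mfderiv I 𝓘(ℝ, F') g x X : F') + B (mfderiv I 𝓘(ℝ, F) f x X : F) (g x) := by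
  rw [(HasMFDerivAt.of_bilinear B hf.hasMFDerivAt hg.hasMFDerivAt).mfderiv]
  rfl

/-- If `dk = B (f, dg)` near `p`, then `B (df u, dg v)` is symmetric in `u` and `v` at `p`. -/
theorem bilinear_fderiv_symm_of_fderiv_eq (B : F →L[ℝ] F' →L[ℝ] G)
    {f : E → F} {g : E → F'} {k : E → G} {p : E} (hf : DifferentiableAt ℝ f p)
    (hg : ContDiffAt ℝ 2 g p) (hk : ContDiffAt ℝ 2 k p)
    (h : ∀ᶠ y in nhds p, ∀ v, fderiv ℝ k y v = B (f y) (fderiv ℝ g y v)) (u v : E) :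
    B (fderiv ℝ f p u) (fderiv ℝ g p v) = B (fderiv ℝ f p v) (fderiv ℝ g p u) := by
  have hg' : DifferentiableAt ℝ (fderiv ℝ g) p :=
    (hg.fderiv_right (m := 1) (by norm_num)).differentiableAt (by norm_num)
  have hk' : DifferentiableAt ℝ (fderiv ℝ k) p :=
    (hk.fderiv_right (m := 1) (by norm_num)).differentiableAt (by norm_num)
  have key (u v : E) : fderiv ℝ (fderiv ℝ k) p u v =
      B (f p) (fderiv ℝ (fderiv ℝ g) p u v) + B (fderiv ℝ f p u) (fderiv ℝ g p v) := by
    have h₁ : HasFDerivAt (fun y => fderiv ℝ g y v) ((fderiv ℝ (fderiv ℝ g) p).flip v) p := by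
      simpa using hg'.hasFDerivAt.clm_apply (hasFDerivAt_const v p)
    have h₂ : HasFDerivAt (fun y => fderiv ℝ k y v) ((fderiv ℝ (fderiv ℝ k) p).flip v) p := by
      simpa using hk'.hasFDerivAt.clm_apply (hasFDerivAt_const v p)
    have h₃ := (B.hasFDerivAt_of_bilinear hf.hasFDerivAt h₁).congr_of_eventuallyEq
      (h.mono fun y hy => hy v)
    simpa using DFunLike.congr_fun (h₂.unique h₃) u
  have sg := hg.isSymmSndFDerivAt (by simp) u v
  have sk := hk.isSymmSndFDerivAt (by simp) u v
  rw [key, key, sg] at sk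
  exact add_left_cancel sk

variable [I.Boundaryless]

theorem MDifferentiableAt.mfderiv_apply_eq_fderiv_extChartAt_symm {w : M → F} {x : M}
    (hw : MDifferentiableAt I 𝓘(ℝ, F) w x) (v : E) :
    (mfderiv I 𝓘(ℝ, F) w x v : F) =
      fderiv ℝ (w ∘ (extChartAt I x).symm) (extChartAt I x x) v := by
  rw [hw.mfderiv, I.range_eq_univ, fderivWithin_univ]
  rfl

variable [IsManifold I (⊤ : ℕ∞) M]

theorem contDiffAt_comp_extChartAt_symm {w : M → F} (hw : ContMDiff I 𝓘(ℝ, F) (⊤ : ℕ∞) w)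
    (x : M) : ContDiffAt ℝ 2 (w ∘ (extChartAt I x).symm) (extChartAt I x x) :=
  ((hw.comp_contMDiffOn (contMDiffOn_extChartAt_symm x)).contDiffOn.contDiffAt
    (extChartAt_target_mem_nhds x)).of_le (WithTop.coe_le_coe.2 (le_top : (2 : ℕ∞) ≤ ⊤))

theorem fderiv_comp_extChartAt_symm_apply {w : M → F} (hw : MDifferentiable I 𝓘(ℝ, F) w)
    {x : M} {y : E} (hy : y ∈ (extChartAt I x).target) (v : E) :
    fderiv ℝ (w ∘ (extChartAt I x).symm) y v =
      (mfderiv I 𝓘(ℝ, F) w ((extChartAt I x).symm y)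
        (mfderiv 𝓘(ℝ, E) I (extChartAt I x).symm y v) : F) := by
  have hs : MDifferentiableAt 𝓘(ℝ, E) I (extChartAt I x).symm y :=
    ((contMDiffOn_extChartAt_symm (n := (⊤ : ℕ∞)) x).contMDiffAt
      ((isOpen_extChartAt_target x).mem_nhds hy)).mdifferentiableAt (by simp)
  rw [← mfderiv_eq_fderiv, mfderiv_comp y (hw _) hs]
  rfl

/-- If `dk = B (f, dg)` on a manifold, then `B (df X, dg Y)` is symmetric in `X` and `Y`. -/
theorem bilinear_mfderiv_symm_of_mfderiv_eq (B : F →L[ℝ] F' →L[ℝ] G)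
    {f : M → F} {g : M → F'} {k : M → G} (hf : ContMDiff I 𝓘(ℝ, F) (⊤ : ℕ∞) f)
    (hg : ContMDiff I 𝓘(ℝ, F') (⊤ : ℕ∞) g) (hk : ContMDiff I 𝓘(ℝ, G) (⊤ : ℕ∞) k)
    (h : ∀ (x : M) (X : TangentSpace I x), (mfderiv I 𝓘(ℝ, G) k x X : G) =
      B (f x) (mfderiv I 𝓘(ℝ, F') g x X : F'))
    (x : M) (X Y : TangentSpace I x) :
    B (mfderiv I 𝓘(ℝ, F) f x X : F) (mfderiv I 𝓘(ℝ, F') g x Y : F') =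
      B (mfderiv I 𝓘(ℝ, F) f x Y : F) (mfderiv I 𝓘(ℝ, F') g x X : F') := by
  have key := bilinear_fderiv_symm_of_fderiv_eq B
    ((contDiffAt_comp_extChartAt_symm hf x).differentiableAt (by norm_num))
    (contDiffAt_comp_extChartAt_symm hg x) (contDiffAt_comp_extChartAt_symm hk x)
    (by
      filter_upwards [extChartAt_target_mem_nhds x] with y hy v
      rw [fderiv_comp_extChartAt_symm_apply (hk.mdifferentiable (by simp)) hy,
        fderiv_comp_extChartAt_symm_apply (hg.mdifferentiable (by simp)) hy]
      exact h _ _) X Y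
  have hf' := (hf.mdifferentiable (by simp) x).mfderiv_apply_eq_fderiv_extChartAt_symm
  have hg' := (hg.mdifferentiable (by simp) x).mfderiv_apply_eq_fderiv_extChartAt_symm
  exact (congrArg₂ (B · ·) (hf' X) (hg' Y)).trans
    (key.trans (congrArg₂ (B · ·) (hf' Y) (hg' X)).symm)

end Bilinear

section Cross

/-- The cross product as a continuous bilinear map. -/
def crossL : ℝ³ →L[ℝ] ℝ³ →L[ℝ] ℝ³ :=
  (LinearMap.mk₂ ℝ cross (fun _ _ _ => by simp [cross]) (fun _ _ _ => by simp [cross])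
    (fun _ _ _ => by simp [cross]) (fun _ _ _ => by simp [cross])).toContinuousBilinearMap

@[simp]
theorem crossL_apply (a b : ℝ³) : crossL a b = cross a b := rfl

theorem cross_eq (a b : ℝ³) :
    cross a b = !₂[a 1 * b 2 - a 2 * b 1, a 2 * b 0 - a 0 * b 2, a 0 * b 1 - a 1 * b 0] := by
  ext i
  fin_cases i <;> simp [cross, cross_apply]

theorem inner_eq_sum_three (a b : ℝ³) : ⟪a, b⟫ = a 0 * b 0 + a 1 * b 1 + a 2 * b 2 := by
  simp [PiLp.inner_apply, Fin.sum_univ_three, mul_comm]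

theorem inner_cross_self_right (a b : ℝ³) : ⟪cross a b, b⟫ = 0 := by
  simp [inner_eq_sum_three, cross_eq]
  ring

theorem cross_eq_neg_cross (a b : ℝ³) : cross a b = -cross b a := by
  ext i
  fin_cases i <;> simp [cross_eq, mul_comm]

theorem inner_cross_cyclic (a b c : ℝ³) : ⟪cross a b, c⟫ = ⟪cross b c, a⟫ := by
  simp [inner_eq_sum_three, cross_eq]
  ring

theorem cross_cross_left (a b c : ℝ³) : cross (cross a b) c = ⟪a, c⟫ • b - ⟪b, c⟫ • a := by
  ext i
  fin_cases i <;> simp [inner_eq_sum_three, cross_eq] <;> ring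

theorem cross_cross_right (a b c : ℝ³) : cross a (cross b c) = ⟪a, c⟫ • b - ⟪a, b⟫ • c := by
  ext i
  fin_cases i <;> simp [inner_eq_sum_three, cross_eq] <;> ring

theorem cross_ne_zero_of_linearIndependent {a b : ℝ³} (h : LinearIndependent ℝ ![a, b]) :
    cross a b ≠ 0 := by
  intro h0
  have hz : ⟪a, a⟫ • b - ⟪b, a⟫ • a = 0 := by
    rw [← cross_cross_left, h0]
    simp [cross]
  have := LinearIndependent.pair_iff.1 h (-⟪b, a⟫) ⟪a, a⟫ (by rw [← hz]; module)
  exact h.ne_zero 0 (by simpa using this.2)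

/-- A vector coplanar with two independent vectors is orthogonal to their common normals. -/
theorem inner_eq_zero_of_inner_cross_eq_zero {a b n w : ℝ³} (h : LinearIndependent ℝ ![a, b])
    (ha : ⟪n, a⟫ = 0) (hb : ⟪n, b⟫ = 0) (hw : ⟪cross a b, w⟫ = 0) : ⟪n, w⟫ = 0 := by
  have hn : cross n (cross a b) = 0 := by simp [cross_cross_right, ha, hb]
  have hc := cross_cross_left n (cross a b) (cross a b)
  rw [hn] at hc
  have key := congrArg (fun v => ⟪v, w⟫) hc
  rw [inner_sub_left, real_inner_smul_left, real_inner_smul_left, hw, mul_zero, zero_sub,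
    ← crossL_apply, map_zero, zero_apply, inner_zero_left, eq_comm, neg_eq_zero] at key
  exact (mul_eq_zero.1 key).resolve_left
    (inner_self_ne_zero.2 (cross_ne_zero_of_linearIndependent h))

end Cross

/-- **Polar duality between metric and Gauss deformations**: the translation vector field
`τ` of an isometric infinitesimal deformation of `φ` is an isogauss infinitesimal
deformation of the polar dual `ψ = ν / h` (whose normal direction at `ψ x` is `φ x`). -/
theorem translation_field_isogauss_of_polar_dual (φ ν ψ ξ η τ : 𝕊² → ℝ³)
    (hφ : Smooth3 φ) (hφimm : ∀ x : 𝕊², Function.Injective (mfd φ x))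
    (hν : IsUnitNormalField φ ν)
    (hh : ∀ x : 𝕊², ⟪ν x, φ x⟫ ≠ 0)
    (hψ : ∀ x : 𝕊², ψ x = (⟪ν x, φ x⟫)⁻¹ • ν x)
    (hξ : IsIsometricDeformation φ ξ)
    (hη : IsRotationField φ ξ η)
    (hτ : ∀ x : 𝕊², τ x = ξ x - cross (η x) (φ x)) :
    (∀ (x : 𝕊²) (X : TangentSpace (𝓡 2) x), ⟪mfd τ x X, φ x⟫ = 0) ∧
      ∀ (x : 𝕊²) (X Y : TangentSpace (𝓡 2) x),
        cross (mfd τ x X) (mfd ψ x Y) + cross (mfd ψ x X) (mfd τ x Y) = 0 := by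
  have hξ' : Smooth3 ξ := hξ.1
  have hη' : Smooth3 η := hη.1
  have hν' : Smooth3 ν := hν.1
  have hψ' : Smooth3 ψ := by
    have hB : ContMDiff (𝓡 2) 𝓘(ℝ, ℝ) (⊤ : ℕ∞) fun x => ⟪ν x, φ x⟫ :=
      contDiff_inner.comp_contMDiff (hν'.prodMk_space hφ)
    rw [show ψ = fun x => (⟪ν x, φ x⟫)⁻¹ • ν x from funext hψ]
    exact (hB.inv₀ hh).smul hν'
  have diff {f : 𝕊² → ℝ³} (hf : Smooth3 f) (x : 𝕊²) : MDifferentiableAt (𝓡 2) 𝓘(ℝ, ℝ³) f x :=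
    hf.mdifferentiable (by simp) x
  have hψφ (x : 𝕊²) : ⟪ψ x, φ x⟫ = 1 := by
    rw [hψ, real_inner_smul_left, inv_mul_cancel₀ (hh x)]
  have hψdφ (x : 𝕊²) (X : TangentSpace (𝓡 2) x) : ⟪ψ x, mfd φ x X⟫ = 0 := by
    rw [hψ, real_inner_smul_left, hν.2.2, mul_zero]
  have hdψφ (x : 𝕊²) (X : TangentSpace (𝓡 2) x) : ⟪mfd ψ x X, φ x⟫ = 0 := by
    have h : (mfderiv (𝓡 2) 𝓘(ℝ, ℝ) (fun y => ⟪ψ y, φ y⟫) x X : ℝ) =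
        ⟪ψ x, mfd φ x X⟫ + ⟪mfd ψ x X, φ x⟫ :=
      mfderiv_bilinear_apply (innerSL ℝ) (diff hψ' x) (diff hφ x) X
    rw [hψdφ, zero_add, show (fun y => ⟪ψ y, φ y⟫) = fun _ => 1 from funext hψφ,
      mfderiv_const] at h
    exact h.symm
  have hdτ (x : 𝕊²) (X : TangentSpace (𝓡 2) x) : mfd τ x X = -cross (mfd η x X) (φ x) := by
    have hc := HasMFDerivAt.of_bilinear crossL (diff hη' x).hasMFDerivAt (diff hφ x).hasMFDerivAt
    have h : mfd τ x X = mfd ξ x X - (cross (η x) (mfd φ x X) + cross (mfd η x X) (φ x)) := by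
      rw [show τ = ξ - fun x => crossL (η x) (φ x) from funext hτ]
      exact DFunLike.congr_fun ((diff hξ' x).hasMFDerivAt.sub hc).mfderiv X
    rw [h, hη.2]
    abel
  have hηφ (x : 𝕊²) (X Y : TangentSpace (𝓡 2) x) :
      cross (mfd η x X) (mfd φ x Y) = cross (mfd η x Y) (mfd φ x X) :=
    bilinear_mfderiv_symm_of_mfderiv_eq crossL hη' hφ hξ' hη.2 x X Y
  have hψdη (x : 𝕊²) (Y : TangentSpace (𝓡 2) x) : ⟪ψ x, mfd η x Y⟫ = 0 := by
    by_cases hY : Y = 0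
    · simp [hY]
    obtain ⟨X, hX⟩ : ∃ X : TangentSpace (𝓡 2) x, LinearIndependent ℝ ![Y, X] :=
      exists_linearIndependent_pair_of_one_lt_finrank (R := ℝ)
        (show 1 < finrank ℝ (EuclideanSpace ℝ (Fin 2)) by simp) hY
    have hli : LinearIndependent ℝ ![mfd φ x Y, mfd φ x X] := by
      rw [LinearIndependent.pair_iff] at hX ⊢
      intro s t h
      refine hX s t (hφimm x ?_)
      rw [map_add, map_smul, map_smul, map_zero]
      exact h
    refine inner_eq_zero_of_inner_cross_eq_zero hli (hψdφ x Y) (hψdφ x X) ?_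
    rw [inner_cross_cyclic, cross_eq_neg_cross, inner_neg_left, hηφ, inner_cross_self_right,
      neg_zero]
  have hψη (x : 𝕊²) (X Y : TangentSpace (𝓡 2) x) :
      ⟪mfd ψ x X, mfd η x Y⟫ = ⟪mfd ψ x Y, mfd η x X⟫ :=
    bilinear_mfderiv_symm_of_mfderiv_eq (innerSL ℝ) hψ' hη' (k := fun _ => (0 : ℝ))
      contMDiff_const (fun x X => by
        rw [mfderiv_const]
        exact (hψdη x X).symm) x X Y
  refine ⟨fun x X => ?_, fun x X Y => ?_⟩
  · rw [hdτ, inner_neg_left, inner_cross_self_right, neg_zero]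
  · rw [hdτ, hdτ]
    simp only [← crossL_apply, map_neg, neg_apply]
    simp only [crossL_apply, cross_cross_left, cross_cross_right]
    rw [hdψφ, real_inner_comm, real_inner_comm (mfd ψ x Y) (φ x), hdψφ, hψη]
    module
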